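/- Fix N ≥ 2 and consider the query Q = R(A) ⋈ S(A) on instances with |R| = N and |S| = 1, so an instance is given by values R[1] < ⋯ < R[N] and S[1]. Then: (a) every such instance admits a certificate of size at most 2; and (b) no deterministic comparison-based decision tree of depth at most ⌊log₂ N⌋ − 1, whose internal nodes compare S[1] with some R[i] (with the three outcomes <, =, >) and whose leaves are labeled with witness sets, is correct on all such instances — for any such tree there exist two instances that follow the same root-to-leaf path but have different witness sets. -/

import Mathlib

/-- Variables of the query `R(A) ⋈ S(A)` with `|R| = N` and `|S| = 1`:
the variables `R[i]` for `i ∈ [N]` and the single variable `S[1]`. -/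
inductive V14 (N : ℕ) where
  | r (i : Fin N)
  | s
deriving DecidableEq

/-- A comparison between two variables, with its outcome. -/
structure C14 (N : ℕ) where
  a : V14 N
  b : V14 N
  o : Ordering
deriving DecidableEq

/-- Value of a variable in the instance given by `r : Fin N → ℕ` (the sorted values of `R`)
and `sv : ℕ` (the value `S[1]`). -/
def evalV {N : ℕ} (r : Fin N → ℕ) (sv : ℕ) : V14 N → ℕ
  | .r i => r i
  | .s => sv

/-- The instance `(r, sv)` satisfies the comparison `c`. -/
def Sat14 {N : ℕ} (r : Fin N → ℕ) (sv : ℕ) (c : C14 N) : Prop :=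
  compare (evalV r sv c.a) (evalV r sv c.b) = c.o

/-- `C` is a certificate: any two instances satisfying all comparisons of `C` have exactly
the same witnesses (a witness being a position `i` with `R[i] = S[1]`). -/
def Cert14 {N : ℕ} (C : Finset (C14 N)) : Prop :=
  ∀ (r r' : Fin N → ℕ) (sv sv' : ℕ), StrictMono r → StrictMono r' →
    (∀ c ∈ C, Sat14 r sv c) → (∀ c ∈ C, Sat14 r' sv' c) →
    ∀ i : Fin N, (r i = sv ↔ r' i = sv')

/-- Ternary decision trees whose internal nodes compare `S[1]` with some `R[i]` and whose
leaves are labeled with witness sets. -/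
inductive T14 (N : ℕ) where
  | leaf (ws : Set (Fin N))
  | node (i : Fin N) (lt eq gt : T14 N)

/-- Depth of a decision tree: the maximum number of comparisons on a root-to-leaf path. -/
def T14.depth {N : ℕ} : T14 N → ℕ
  | .leaf _ => 0
  | .node _ l e g => max (max (T14.depth l) (T14.depth e)) (T14.depth g) + 1

/-- The root-to-leaf path followed by the tree on the instance `(r, sv)`: the list of
comparisons made (index compared with `S[1]`) together with their outcomes. -/
def T14.path {N : ℕ} (r : Fin N → ℕ) (sv : ℕ) : T14 N → List (Fin N × Ordering)
  | .leaf _ => []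
  | .node i l e g =>
    match compare sv (r i) with
    | .lt => (i, Ordering.lt) :: T14.path r sv l
    | .eq => (i, Ordering.eq) :: T14.path r sv e
    | .gt => (i, Ordering.gt) :: T14.path r sv g

/-- Some two positions of `S[1]` relative to `R[a], …, R[b-1]`, where `R[i] = 2 * i + 1`, are not
distinguished by a tree of depth `d` with `2 ^ d ≤ b - a`, and yield different witnesses. -/
theorem T14.exists_path_eq {N : ℕ} (T : T14 N) (d a b : ℕ) (hT : T.depth ≤ d)
    (hab : a + 2 ^ d ≤ b) (hb : b ≤ N) :
    ∃ (j : Fin N) (sv sv' : ℕ), 2 * a ≤ sv ∧ sv ≤ 2 * b ∧ 2 * a ≤ sv' ∧ sv' ≤ 2 * b ∧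
      T.path (fun i : Fin N => 2 * (i : ℕ) + 1) sv =
        T.path (fun i : Fin N => 2 * (i : ℕ) + 1) sv' ∧
      2 * (j : ℕ) + 1 = sv ∧ 2 * (j : ℕ) + 1 ≠ sv' := by
  induction T generalizing d a b with
  | leaf ws =>
    have : 0 < 2 ^ d := by positivity
    exact ⟨⟨a, by omega⟩, 2 * a + 1, 2 * a, by omega, by omega, by omega, by omega, rfl, rfl,
      by simp⟩
  | node i l e g ihl ihe ihg =>
    simp only [T14.depth] at hT
    obtain ⟨d, rfl⟩ : ∃ k, d = k + 1 := ⟨d - 1, by omega⟩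
    rw [pow_succ] at hab
    by_cases h : a + 2 ^ d ≤ i
    · obtain ⟨j, s, s', h₁, h₂, h₃, h₄, hp, hj, hj'⟩ :=
        ihl d a (min b i) (by omega) (by omega) (by omega)
      have c : compare s (2 * (i : ℕ) + 1) = .lt := compare_lt_iff_lt.2 (by omega)
      have c' : compare s' (2 * (i : ℕ) + 1) = .lt := compare_lt_iff_lt.2 (by omega)
      exact ⟨j, s, s', h₁, by omega, h₃, by omega, by simp only [T14.path, c, c', hp], hj, hj'⟩
    · obtain ⟨j, s, s', h₁, h₂, h₃, h₄, hp, hj, hj'⟩ :=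
        ihg d (max a (i + 1)) b (by omega) (by omega) hb
      have c : compare s (2 * (i : ℕ) + 1) = .gt := compare_gt_iff_gt.2 (by omega)
      have c' : compare s' (2 * (i : ℕ) + 1) = .gt := compare_gt_iff_gt.2 (by omega)
      exact ⟨j, s, s', by omega, h₂, by omega, h₄, by simp only [T14.path, c, c', hp], hj, hj'⟩

/-- The comparison `R[i] = S[1]` certifies that `i` is the only witness. -/
theorem cert14_eq {N : ℕ} (i : Fin N) : Cert14 {⟨.r i, .s, .eq⟩} := by
  intro r r' sv sv' hr hr' h h' j
  simp only [Finset.mem_singleton, forall_eq, Sat14, evalV, compare_eq_iff_eq] at h h'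
  rw [← h, ← h', hr.injective.eq_iff, hr'.injective.eq_iff]

/-- A set of comparisons forcing `R[j] < S[1]` for `j < k` and `S[1] < R[j]` for `k ≤ j`
certifies that there is no witness. -/
theorem cert14_of_gap {N : ℕ} {C : Finset (C14 N)} (k : ℕ) (hk : k ≤ N)
    (hlt : ∀ i : Fin N, (i : ℕ) + 1 = k → ⟨.r i, .s, .lt⟩ ∈ C)
    (hgt : ∀ i : Fin N, (i : ℕ) = k → ⟨.r i, .s, .gt⟩ ∈ C) : Cert14 C := by
  have noWitness (r : Fin N → ℕ) (sv : ℕ) (hr : StrictMono r) (h : ∀ c ∈ C, Sat14 r sv c)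
      (j : Fin N) : r j ≠ sv := by
    have hj := j.isLt
    rcases lt_or_ge (j : ℕ) k with hjk | hjk
    · have hs := h _ (hlt ⟨k - 1, by omega⟩ (by simp only; omega))
      have hle : r j ≤ r ⟨k - 1, by omega⟩ := hr.monotone (Fin.le_def.2 (by simp only; omega))
      exact (hle.trans_lt (compare_lt_iff_lt.1 hs)).ne
    · have hs := h _ (hgt ⟨k, by omega⟩ rfl)
      have hle : r ⟨k, by omega⟩ ≤ r j := hr.monotone (Fin.le_def.2 hjk)
      exact ((compare_gt_iff_gt.1 hs).trans_le hle).ne'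
  intro r r' sv sv' hr hr' h h' i
  simp [noWitness r sv hr h i, noWitness r' sv' hr' h' i]

/-- Every instance admits a certificate of size at most `2`. -/
theorem exists_cert14_card_le_two {N : ℕ} (r : Fin N → ℕ) (sv : ℕ) (hr : StrictMono r) :
    ∃ C : Finset (C14 N), Cert14 C ∧ (∀ c ∈ C, Sat14 r sv c) ∧ C.card ≤ 2 := by
  by_cases hw : ∃ i, r i = sv
  · obtain ⟨i, hi⟩ := hw
    exact ⟨_, cert14_eq i, by simp [Sat14, evalV, hi], by simp⟩
  push Not at hw
  have hex : ∃ k, k ≤ N ∧ ∀ i : Fin N, k ≤ (i : ℕ) → sv < r i :=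
    ⟨N, le_rfl, fun i hi => absurd i.isLt (by omega)⟩
  classical
  set k := Nat.find hex
  obtain ⟨hkN, hk⟩ := Nat.find_spec hex
  have hbelow (i : Fin N) (hi : (i : ℕ) + 1 = k) : r i < sv := by
    by_contra hlt
    refine Nat.find_min hex (m := i) (by omega) ⟨by omega, fun j hj => ?_⟩
    exact (lt_of_le_of_ne (not_lt.1 hlt) (hw i).symm).trans_le (hr.monotone (Fin.le_def.2 hj))
  have hcard (m : ℕ) (f : Fin N → ℕ) (hf : Function.Injective f) :
      (Finset.univ.filter fun i => f i = m).card ≤ 1 :=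
    Finset.card_le_one.2 fun i hi j hj => hf (by simp_all)
  refine ⟨(Finset.univ.filter fun i : Fin N => (i : ℕ) + 1 = k).image (fun i => ⟨.r i, .s, .lt⟩) ∪
    (Finset.univ.filter fun i : Fin N => (i : ℕ) = k).image (fun i => ⟨.r i, .s, .gt⟩),
    cert14_of_gap k hkN ?_ ?_, ?_, ?_⟩
  · intro i hi
    simp [hi]
  · intro i hi
    simp [hi]
  · intro c hc
    simp only [Finset.mem_union, Finset.mem_image, Finset.mem_filter, Finset.mem_univ,
      true_and] at hc
    rcases hc with ⟨i, hi, rfl⟩ | ⟨i, hi, rfl⟩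
    · exact compare_lt_iff_lt.2 (hbelow i hi)
    · exact compare_gt_iff_gt.2 (hk i hi.ge)
  · refine (Finset.card_union_le _ _).trans (add_le_add (b := 1) (d := 1) ?_ ?_)
    · exact Finset.card_image_le.trans
        (hcard k (fun i => (i : ℕ) + 1) fun i j h => Fin.ext (by simpa using h))
    · exact Finset.card_image_le.trans (hcard k (fun i => (i : ℕ)) Fin.val_injective)

/-- For the query `R(A) ⋈ S(A)` with `|R| = N ≥ 2` and `|S| = 1`:
(a) every instance admits a certificate of size at most `2`; and
(b) no decision tree of depth at most `⌊log₂ N⌋ - 1` comparing `S[1]` against elements of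
`R` is correct on all instances: some two instances follow the same root-to-leaf path yet
have different witness sets. -/
theorem stmt_14 (N : ℕ) (hN : 2 ≤ N) :
    (∀ (r : Fin N → ℕ) (sv : ℕ), StrictMono r →
      ∃ C : Finset (C14 N), Cert14 C ∧ (∀ c ∈ C, Sat14 r sv c) ∧ C.card ≤ 2) ∧
    (∀ T : T14 N, T.depth ≤ Nat.log 2 N - 1 →
      ∃ (r r' : Fin N → ℕ) (sv sv' : ℕ), StrictMono r ∧ StrictMono r' ∧
        T.path r sv = T.path r' sv' ∧
        ¬ ∀ i : Fin N, (r i = sv ↔ r' i = sv')) := by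
  refine ⟨exists_cert14_card_le_two, fun T hT => ?_⟩
  have hpow : 2 ^ (Nat.log 2 N - 1) ≤ N :=
    (Nat.pow_le_pow_right two_pos (Nat.sub_le _ _)).trans (Nat.pow_log_le_self 2 (by omega))
  obtain ⟨j, s, s', -, -, -, -, hp, hj, hj'⟩ :=
    T.exists_path_eq _ 0 N hT (by simpa using hpow) le_rfl
  have hr : StrictMono fun i : Fin N => 2 * (i : ℕ) + 1 := fun i j h => by
    have := Fin.lt_def.1 h
    simp only
    omega
  exact ⟨_, _, s, s', hr, hr, hp, fun h => hj' ((h j).1 hj)⟩
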